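/- For all integers n, r ≥ 2, the variety C_r(Mat_n(k)) is irreducible in the Zariski topology if and only if C_r(Mat_n(k)) = G_n^r; moreover G_n^r has dimension n² + (r−1)n, so if C_r(Mat_n(k)) is irreducible then dim C_r(Mat_n(k)) = n² + (r−1)n. -/

import Mathlib

open MvPolynomial Matrix TopologicalSpace

/-- The Zariski topology on `r`-tuples of `n × n` matrices over `k`, identified with
affine space `k^(r·n²)`: the topology generated by complements of hypersurfaces
(its closed sets are exactly the common zero loci of families of polynomials in the
matrix entries). -/
noncomputable def matTupleZariski (k : Type*) [CommRing k] (n r : ℕ) :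
    TopologicalSpace (Fin r → Matrix (Fin n) (Fin n) k) :=
  TopologicalSpace.generateFrom
    {U | ∃ p : MvPolynomial (Fin r × Fin n × Fin n) k,
      U = {x | MvPolynomial.eval (fun q => x q.1 q.2.1 q.2.2) p ≠ 0}}

/-- `C_r(Mat_n(k))`: the set of commuting `r`-tuples of `n × n` matrices. -/
def commTuples (k : Type*) [Field k] (n r : ℕ) :
    Set (Fin r → Matrix (Fin n) (Fin n) k) :=
  {x | ∀ i j, x i * x j = x j * x i}

/-- `G_n^r`: the Zariski closure of the set of commuting `r`-tuples whose first entry is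
nonderogatory (its minimal polynomial has degree `n`). -/
noncomputable def Gnr (k : Type*) [Field k] (n r : ℕ) :
    Set (Fin r → Matrix (Fin n) (Fin n) k) :=
  letI := matTupleZariski k n r
  closure {x | x ∈ commTuples k n r ∧
    ∀ i : Fin r, (i : ℕ) = 0 → (minpoly k (x i)).natDegree = n}

/-- The Krylov matrix of `M` at `v`, with columns `v, M v, …, M ^ (n - 1) v`. -/
def krylov {R : Type*} [CommRing R] {n : ℕ} (M : Matrix (Fin n) (Fin n) R) (v : Fin n → R) :
    Matrix (Fin n) (Fin n) R :=
  of fun i j => ((M ^ (j : ℕ)) *ᵥ v) i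

section krylov

variable {R : Type*} [CommRing R] {n : ℕ}

theorem krylov_mulVec (M : Matrix (Fin n) (Fin n) R) (v c : Fin n → R) :
    krylov M v *ᵥ c = (∑ j, c j • M ^ (j : ℕ)) *ᵥ v := by
  ext i
  simp only [krylov, mulVec, dotProduct, of_apply, Matrix.sum_apply, Matrix.smul_apply,
    smul_eq_mul, Finset.sum_mul]
  rw [Finset.sum_comm]
  exact Finset.sum_congr rfl fun _ _ => Finset.sum_congr rfl fun _ _ => by ring

theorem map_krylov {S : Type*} [CommRing S] (f : R →+* S) (M : Matrix (Fin n) (Fin n) R)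
    (v : Fin n → R) : (krylov M v).map f = krylov (M.map f) (f ∘ v) := by
  ext i j
  simp [krylov, RingHom.map_mulVec, ← RingHom.mapMatrix_apply]

theorem krylov_diagonal_one (a : Fin n → R) : krylov (diagonal a) 1 = vandermonde a := by
  ext i j
  simp [krylov, diagonal_pow, mulVec_diagonal, vandermonde_apply]

theorem eq_sum_smul_pow_of_commute {k : Type*} [Field k] {M Y : Matrix (Fin n) (Fin n) k}
    {v : Fin n → k} (hv : (krylov M v).det ≠ 0) (h : Commute Y M) :
    ∃ c : Fin n → k, Y = ∑ j, c j • M ^ (j : ℕ) := by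
  have hu : IsUnit (krylov M v) := (isUnit_iff_isUnit_det _).2 hv.isUnit
  set c := (krylov M v)⁻¹ *ᵥ (Y *ᵥ v) with hc
  refine ⟨c, ?_⟩
  set Q := ∑ j, c j • M ^ (j : ℕ) with hQ
  have hQv : Q *ᵥ v = Y *ᵥ v := by
    rw [hQ, ← krylov_mulVec, hc, mulVec_mulVec, mul_nonsing_inv _ hv.isUnit, one_mulVec]
  have hQM : Commute Q M := Commute.sum_left _ _ _ fun j _ =>
    ((Commute.refl M).pow_left _).smul_left _
  refine hu.mul_left_injective ?_
  have key : ∀ Z : Matrix (Fin n) (Fin n) k, Commute Z M → ∀ i j,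
      (Z * krylov M v) i j = ((M ^ (j : ℕ)) *ᵥ (Z *ᵥ v)) i := by
    intro Z hZ i j
    rw [mulVec_mulVec, ← (hZ.pow_right (j : ℕ)).eq, ← mulVec_mulVec]
    rfl
  ext i j
  simp only [key Y h, key Q hQM, hQv]

theorem aeval_sum_C_mul_X_pow (M : Matrix (Fin n) (Fin n) R) (c : Fin n → R) :
    Polynomial.aeval M (∑ j, Polynomial.C (c j) * Polynomial.X ^ (j : ℕ)) =
      ∑ j, c j • M ^ (j : ℕ) := by
  simp [Algebra.smul_def]

open scoped Classical in
theorem natDegree_minpoly_eq_iff_exists_krylov {k : Type*} [Field k] [Infinite k]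
    (M : Matrix (Fin n) (Fin n) k) :
    (minpoly k M).natDegree = n ↔ ∃ v, (krylov M v).det ≠ 0 := by
  have hint : IsIntegral k M := Algebra.IsIntegral.isIntegral M
  have hle : (minpoly k M).natDegree ≤ n := by
    simpa [charpoly_natDegree_eq_dim] using
      Polynomial.natDegree_le_of_dvd (minpoly_dvd_charpoly M) (charpoly_monic M).ne_zero
  constructor
  · intro hdeg
    by_contra! H
    let ι := {g : Polynomial k // g.Monic ∧ g ∣ minpoly k M}
    have : Finite {g : ι // g.1.natDegree < n} :=
      have : Fintype ι := Polynomial.fintypeSubtypeMonicDvd _ (minpoly.ne_zero hint)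
      inferInstance
    let W : {g : ι // g.1.natDegree < n} → Submodule k (Fin n → k) := fun g =>
      LinearMap.ker (Matrix.toLin' (Polynomial.aeval M g.1.1))
    have hcov : ⋃ g, (W g : Set (Fin n → k)) = Set.univ := by
      refine Set.eq_univ_of_forall fun v => ?_
      obtain ⟨c, hc0, hc⟩ := exists_mulVec_eq_zero_iff.2 (H v)
      set q : Polynomial k := ∑ j : Fin n, Polynomial.C (c j) * Polynomial.X ^ (j : ℕ) with hq
      have hqdeg : q.degree < n := Polynomial.degree_sum_fin_lt c
      have hq0 : q ≠ 0 := by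
        intro h0
        refine hc0 (funext fun j => ?_)
        have := congrArg (Polynomial.coeff · (j : ℕ)) h0
        simpa [hq, Polynomial.finsetSum_coeff, Polynomial.coeff_X_pow, Fin.val_inj] using this
      have hqv : (Polynomial.aeval M q) *ᵥ v = 0 := by
        rw [aeval_sum_C_mul_X_pow, ← krylov_mulVec, hc]
      set g := EuclideanDomain.gcd q (minpoly k M) with hg
      have hg0 : g ≠ 0 := fun h => hq0 (EuclideanDomain.gcd_eq_zero_iff.1 h).1
      have hgv : (Polynomial.aeval M g) *ᵥ v = 0 := by
        rw [hg, EuclideanDomain.gcd_eq_gcd_ab, mul_comm q, map_add, map_mul, map_mul,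
          minpoly.aeval, zero_mul, add_zero, ← mulVec_mulVec, hqv, mulVec_zero]
      have hdvd : g * Polynomial.C g.leadingCoeff⁻¹ ∣ minpoly k M :=
        (Polynomial.isUnit_C.2 (by simpa using hg0)).mul_right_dvd.2
          (EuclideanDomain.gcd_dvd_right _ _)
      refine Set.mem_iUnion.2 ⟨⟨⟨g * Polynomial.C g.leadingCoeff⁻¹,
        Polynomial.monic_mul_leadingCoeff_inv hg0, hdvd⟩, ?_⟩, ?_⟩
      · rw [Polynomial.natDegree_mul_leadingCoeff_inv _ hg0]
        exact (Polynomial.natDegree_le_of_dvd (EuclideanDomain.gcd_dvd_left _ _) hq0).trans_lt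
          ((Polynomial.natDegree_lt_iff_degree_lt hq0).2 hqdeg)
      · have : Polynomial.aeval M (g * Polynomial.C g.leadingCoeff⁻¹) =
            g.leadingCoeff⁻¹ • Polynomial.aeval M g := by
          rw [mul_comm, ← Polynomial.smul_eq_C_mul, map_smul]
        simp only [W, SetLike.mem_coe, LinearMap.mem_ker, toLin'_apply, this, smul_mulVec, hgv,
          smul_zero]
    obtain ⟨⟨⟨g, hgm, hgd⟩, hgn⟩, hW⟩ := Subspace.exists_eq_top_of_iUnion_eq_univ hcov
    have hg : Polynomial.aeval M g = 0 := by
      simpa [W, LinearMap.ker_eq_top] using hW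
    exact (Polynomial.natDegree_le_natDegree (minpoly.min k M hgm hg)).not_gt (hdeg.symm ▸ hgn)
  · rintro ⟨v, hv⟩
    refine hle.antisymm (not_lt.1 fun hlt => hv ?_)
    refine exists_mulVec_eq_zero_iff.1 ⟨fun j => (minpoly k M).coeff j, fun h => ?_, ?_⟩
    · have := congrFun h ⟨_, hlt⟩
      simp [minpoly.ne_zero hint] at this
    · have : (∑ j : Fin n, (minpoly k M).coeff j • M ^ (j : ℕ)) = 0 := by
        rw [← minpoly.aeval k M, Polynomial.aeval_eq_sum_range' hlt,
          Fin.sum_univ_eq_sum_range (fun j => (minpoly k M).coeff j • M ^ j)]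
      rw [krylov_mulVec, this, zero_mulVec]

end krylov

theorem ringKrullDim_eq_of_isIntegral (R S : Type*) [CommRing R] [CommRing S] [Algebra R S]
    [Algebra.IsIntegral R S] [FaithfulSMul R S] : ringKrullDim R = ringKrullDim S := by
  refine le_antisymm (iSup_le fun l => ?_) ?_
  · obtain ⟨P, hP, hPl⟩ : (Ideal.primesOver l.head.asIdeal S).Nonempty :=
      Set.nonempty_coe_sort.1 inferInstance
    obtain ⟨L, hL, -⟩ := Ideal.exists_ltSeries_of_hasGoingUp l P
    rw [← hL]
    exact Order.LTSeries.length_le_krullDim L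
  · exact Order.krullDim_le_of_strictMono (PrimeSpectrum.comap (algebraMap R S))
      fun _ _ h => Ideal.IsIntegral.comap_lt_comap h

theorem ringKrullDim_quotient_ker_eq_card {k A τ : Type*} [Field k] [CommRing A] [Algebra k A]
    [Algebra.FiniteType k A] [Fintype τ] (φ : A →ₐ[k] MvPolynomial τ k)
    (h : ∀ t, ∃ d a, φ d ≠ 0 ∧ φ d * X t = φ a) :
    ringKrullDim (A ⧸ RingHom.ker φ) = Fintype.card τ := by
  let B := φ.range
  have hB : Algebra.FiniteType k B := Algebra.FiniteType.of_surjective φ.rangeRestrict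
    φ.rangeRestrict_surjective
  rw [ringKrullDim_eq_of_ringEquiv (Ideal.quotientKerEquivRange φ).toRingEquiv]
  have halg : Algebra.IsAlgebraic B (MvPolynomial τ k) := by
    have hX : ∀ t, IsAlgebraic B (X t : MvPolynomial τ k) := by
      intro t
      obtain ⟨d, a, hd, hda⟩ := h t
      refine ⟨Polynomial.C (φ.rangeRestrict d) * Polynomial.X - Polynomial.C (φ.rangeRestrict a),
        fun h0 => hd ?_, ?_⟩
      · have := congrArg (Polynomial.coeff · 1) h0
        simpa [Polynomial.coeff_C] using congrArg Subtype.val this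
      · simpa [sub_eq_zero] using hda
    refine ⟨fun p => ?_⟩
    induction p using MvPolynomial.induction_on with
    | C a => exact isAlgebraic_algebraMap (algebraMap k B a)
    | add p q hp hq => exact hp.add hq
    | mul_X p t hp => exact hp.mul (hX t)
  obtain ⟨s, g, hg, hgint⟩ := exists_integral_inj_algHom_of_fg k B
  let := g.toRingHom.toAlgebra
  have : Algebra.IsIntegral (MvPolynomial (Fin s) k) B := ⟨hgint⟩
  have : FaithfulSMul (MvPolynomial (Fin s) k) B := (faithfulSMul_iff_algebraMap_injective _ _).2 hg
  let := ((algebraMap B (MvPolynomial τ k)).comp g.toRingHom).toAlgebra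
  have : IsScalarTower (MvPolynomial (Fin s) k) B (MvPolynomial τ k) := .of_algebraMap_eq' rfl
  have : FaithfulSMul (MvPolynomial (Fin s) k) (MvPolynomial τ k) :=
    (faithfulSMul_iff_algebraMap_injective _ _).2 (Subtype.val_injective.comp hg)
  have : IsScalarTower k (MvPolynomial (Fin s) k) (MvPolynomial τ k) :=
    .of_algebraMap_eq fun x => by
      change _ = (g (algebraMap k _ x) : MvPolynomial τ k)
      rw [g.commutes]; rfl
  have : Algebra.IsAlgebraic (MvPolynomial (Fin s) k) (MvPolynomial τ k) :=
    Algebra.IsAlgebraic.trans _ B _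
  have key := lift_trdeg_add_eq k (MvPolynomial (Fin s) k) (MvPolynomial τ k)
  have hs : s = Fintype.card τ := by
    simpa [MvPolynomial.trdeg_of_isDomain, trdeg_eq_zero] using key
  change ringKrullDim B = _
  rw [← ringKrullDim_eq_of_isIntegral (MvPolynomial (Fin s) k) B]
  simp [hs]

section VeryDense

variable {X Y : Type*} [TopologicalSpace X] [TopologicalSpace Y] {f : X → Y}

theorem Topology.IsInducing.isIrreducible_of_image (hf : Topology.IsInducing f) {s : Set X}
    (h : IsIrreducible (f '' s)) : IsIrreducible s := by
  refine ⟨Set.image_nonempty.1 h.1, fun u' v' hu' hv' => ?_⟩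
  obtain ⟨u, hu, rfl⟩ := hf.isOpen_iff.1 hu'
  obtain ⟨v, hv, rfl⟩ := hf.isOpen_iff.1 hv'
  rintro ⟨x, hx, hxu⟩ ⟨y, hy, hyv⟩
  obtain ⟨-, ⟨z, hz, rfl⟩, hzu⟩ := h.2 u v hu hv ⟨_, ⟨x, hx, rfl⟩, hxu⟩ ⟨_, ⟨y, hy, rfl⟩, hyv⟩
  exact ⟨z, hz, hzu⟩

theorem Topology.IsInducing.isIrreducible_preimage (hf : Topology.IsInducing f)
    (hd : ∀ C, IsClosed C → closure (C ∩ Set.range f) = C) {C : Set Y} (hC : IsClosed C)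
    (h : IsIrreducible C) : IsIrreducible (f ⁻¹' C) := by
  refine hf.isIrreducible_of_image ?_
  rwa [Set.image_preimage_eq_inter_range, ← isIrreducible_iff_closure, hd C hC]

theorem Topology.IsInducing.topologicalKrullDim_eq (hf : Topology.IsInducing f)
    (hd : ∀ C, IsClosed C → closure (C ∩ Set.range f) = C) :
    topologicalKrullDim X = topologicalKrullDim Y := by
  refine hf.topologicalKrullDim_le.antisymm ?_
  refine Order.krullDim_le_of_strictMono (fun C : IrreducibleCloseds Y =>
    (⟨f ⁻¹' C, hf.isIrreducible_preimage hd C.isClosed C.isIrreducible,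
      C.isClosed.preimage hf.continuous⟩ : IrreducibleCloseds X)) ?_
  refine Monotone.strictMono_of_injective (fun C D h x hx => h hx) fun C D h => ?_
  have h' : f ⁻¹' C = f ⁻¹' D := congrArg (fun E : IrreducibleCloseds X => (E : Set X)) h
  refine IrreducibleCloseds.ext ?_
  rw [← hd C C.isClosed, ← hd D D.isClosed, ← Set.image_preimage_eq_inter_range, h',
    Set.image_preimage_eq_inter_range]

theorem Topology.IsInducing.topologicalKrullDim_preimage_eq (hf : Topology.IsInducing f)
    (hd : ∀ C, IsClosed C → closure (C ∩ Set.range f) = C) {Z : Set Y} (hZ : IsClosed Z) :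
    topologicalKrullDim (f ⁻¹' Z) = topologicalKrullDim Z := by
  refine Topology.IsInducing.topologicalKrullDim_eq (f := Z.restrictPreimage f)
    (hf.restrictPreimage Z) fun C hC => ?_
  have hC' : IsClosed (Subtype.val '' C : Set Y) := hZ.isClosedEmbedding_subtypeVal.isClosedMap C hC
  rw [Topology.IsInducing.subtypeVal.closure_eq_preimage_closure_image]
  have : Subtype.val '' (C ∩ Set.range (Z.restrictPreimage f)) =
      Subtype.val '' C ∩ Set.range f := by
    ext y
    constructor
    · rintro ⟨-, ⟨hz, x, rfl⟩, rfl⟩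
      exact ⟨⟨_, hz, rfl⟩, x.1, rfl⟩
    · rintro ⟨⟨z, hz, rfl⟩, x, hx⟩
      exact ⟨z, ⟨hz, ⟨x, show f x ∈ Z from hx ▸ z.2⟩, Subtype.ext hx⟩, rfl⟩
  rw [this, hd _ hC', Set.preimage_image_eq _ Subtype.val_injective]

end VeryDense

theorem PrimeSpectrum.topologicalKrullDim_zeroLocus {R : Type*} [CommRing R] (I : Ideal R) :
    topologicalKrullDim (PrimeSpectrum.zeroLocus (I : Set R)) = ringKrullDim (R ⧸ I) := by
  rw [ringKrullDim_quotient, topologicalKrullDim, ← Order.krullDim_orderDual]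
  exact (Order.krullDim_eq_of_orderIso
    (PrimeSpectrum.zeroLocusEquivIrreducibleCloseds (I : Set R))).symm

theorem closure_inter_range_pointToPoint {k σ : Type*} [Field k] [IsAlgClosed k] [Finite σ]
    {C : Set (PrimeSpectrum (MvPolynomial σ k))} (hC : IsClosed C) :
    closure (C ∩ Set.range (pointToPoint (k := k) (K := k) (σ := σ))) = C := by
  refine (closure_minimal Set.inter_subset_left hC).antisymm ?_
  nth_rw 1 [← hC.closure_eq, ← JacobsonSpace.closure_inter_closedPoints_eq_closure
    hC.isLocallyClosed]
  refine closure_mono (Set.inter_subset_inter_right _ fun p hp => ?_)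
  obtain ⟨x, hx⟩ := isMaximal_iff_eq_vanishingIdeal_singleton.1
    ((PrimeSpectrum.isClosed_singleton_iff_isMaximal p).1 hp)
  exact ⟨x, PrimeSpectrum.ext hx.symm⟩

section Zariski

variable {k : Type*} [Field k] {n r : ℕ}

/-- The point of affine space `k ^ (r * n ^ 2)` given by the entries of a tuple of matrices. -/
def entries {R : Type*} (x : Fin r → Matrix (Fin n) (Fin n) R) : Fin r × Fin n × Fin n → R :=
  fun q => x q.1 q.2.1 q.2.2

/-- A tuple of matrices as a point of the prime spectrum of the coordinate ring. -/
noncomputable def toSpec (x : Fin r → Matrix (Fin n) (Fin n) k) :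
    PrimeSpectrum (MvPolynomial (Fin r × Fin n × Fin n) k) :=
  pointToPoint (entries x)

theorem mem_toSpec_asIdeal {x : Fin r → Matrix (Fin n) (Fin n) k}
    {p : MvPolynomial (Fin r × Fin n × Fin n) k} :
    p ∈ (toSpec x).asIdeal ↔ eval (entries x) p = 0 := by
  change p ∈ vanishingIdeal k {entries x} ↔ _
  rw [mem_vanishingIdeal_singleton_iff, aeval_eq_eval]

theorem isInducing_toSpec :
    letI := matTupleZariski k n r
    Topology.IsInducing (toSpec : (Fin r → Matrix (Fin n) (Fin n) k) → _) := by
  let := matTupleZariski k n r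
  refine ⟨?_⟩
  rw [PrimeSpectrum.isTopologicalBasis_basic_opens.eq_generateFrom, induced_generateFrom_eq]
  change generateFrom _ = _
  congr 1
  ext U
  simp only [Set.mem_ofPred_eq, Set.mem_image, Set.mem_range, exists_exists_eq_and]
  refine exists_congr fun p => eq_comm.trans (Eq.congr ?_ rfl)
  ext x
  change _ ↔ p ∉ (toSpec x).asIdeal
  rw [mem_toSpec_asIdeal]
  rfl

theorem closure_inter_range_toSpec [IsAlgClosed k]
    (C : Set (PrimeSpectrum (MvPolynomial (Fin r × Fin n × Fin n) k))) (hC : IsClosed C) :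
    closure (C ∩ Set.range (toSpec : (Fin r → Matrix (Fin n) (Fin n) k) → _)) = C := by
  have : Function.Surjective
      (entries : (Fin r → Matrix (Fin n) (Fin n) k) → Fin r × Fin n × Fin n → k) :=
    fun y => ⟨fun i => of fun a b => y (i, a, b), rfl⟩
  have h : Set.range (toSpec : (Fin r → Matrix (Fin n) (Fin n) k) → _) =
      Set.range pointToPoint := this.range_comp _
  rw [h, closure_inter_range_pointToPoint hC]

theorem isClosed_setOf_eval_eq_zero (p : MvPolynomial (Fin r × Fin n × Fin n) k) :
    letI := matTupleZariski k n r
    IsClosed {x : Fin r → Matrix (Fin n) (Fin n) k | eval (entries x) p = 0} := by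
  let := matTupleZariski k n r
  exact ⟨isOpen_generateFrom_of_mem ⟨p, rfl⟩⟩

/-- The generic `r`-tuple of matrices. -/
noncomputable def genericTuple (k : Type*) [Field k] (n r : ℕ) (i : Fin r) :
    Matrix (Fin n) (Fin n) (MvPolynomial (Fin r × Fin n × Fin n) k) :=
  of fun a b => X (i, a, b)

theorem map_genericTuple {S : Type*} [CommRing S] (f : MvPolynomial (Fin r × Fin n × Fin n) k →+* S)
    {x : Fin r → Matrix (Fin n) (Fin n) S} (hf : ∀ q, f (X q) = entries x q) (i : Fin r) :
    (genericTuple k n r i).map f = x i := by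
  ext a b
  exact hf (i, a, b)

theorem isClosed_commTuples :
    letI := matTupleZariski k n r
    IsClosed (commTuples k n r) := by
  let := matTupleZariski k n r
  have : commTuples k n r = ⋂ i, ⋂ j, ⋂ a, ⋂ b, {x | eval (entries x)
      ((genericTuple k n r i * genericTuple k n r j -
        genericTuple k n r j * genericTuple k n r i) a b) = 0} := by
    ext x
    simp only [commTuples, Set.mem_ofPred_eq, Set.mem_iInter]
    refine forall₂_congr fun i j => ?_
    rw [← sub_eq_zero, ← Matrix.ext_iff]
    refine forall₂_congr fun a b => ?_
    have hx := map_genericTuple (eval (entries x)) (x := x) (fun q => eval_X q)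
    have : (genericTuple k n r i * genericTuple k n r j -
        genericTuple k n r j * genericTuple k n r i).map (eval (entries x)) =
        x i * x j - x j * x i := by
      rw [Matrix.map_sub _ (map_sub _), Matrix.map_mul, Matrix.map_mul, hx, hx]
    rw [← this, Matrix.map_apply, Matrix.zero_apply]
  rw [this]
  exact isClosed_iInter fun i => isClosed_iInter fun j => isClosed_iInter fun a =>
    isClosed_iInter fun b => isClosed_setOf_eval_eq_zero _

theorem isOpen_setOf_nonderogatory [Infinite k] (i : Fin r) :
    letI := matTupleZariski k n r
    IsOpen {x : Fin r → Matrix (Fin n) (Fin n) k | (minpoly k (x i)).natDegree = n} := by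
  let := matTupleZariski k n r
  have : {x : Fin r → Matrix (Fin n) (Fin n) k | (minpoly k (x i)).natDegree = n} =
      ⋃ v : Fin n → k, {x | eval (entries x) (krylov (genericTuple k n r i) (C ∘ v)).det = 0}ᶜ := by
    ext x
    simp only [Set.mem_ofPred_eq, Set.mem_iUnion, Set.mem_compl_iff,
      natDegree_minpoly_eq_iff_exists_krylov]
    refine exists_congr fun v => ?_
    rw [RingHom.map_det, RingHom.mapMatrix_apply, map_krylov,
      map_genericTuple (eval (entries x)) (x := x) fun q => eval_X q, ← Function.comp_assoc]
    simp [Function.comp_def]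
  rw [this]
  exact isOpen_iUnion fun v => (isClosed_setOf_eval_eq_zero _).isOpen_compl

end Zariski

section Parametrization

variable {n s : ℕ}

/-- The commuting tuple `(M, ∑ⱼ t₁ⱼ M ^ j, …, ∑ⱼ tₛⱼ M ^ j)` attached to the entries of a matrix
`M` and the coefficients of `s` polynomials of degree less than `n`. -/
def polyTuple {R : Type*} [CommRing R] (t : (Fin n × Fin n) ⊕ (Fin s × Fin n) → R) :
    Fin (s + 1) → Matrix (Fin n) (Fin n) R :=
  Fin.cons (of fun a b => t (.inl (a, b))) fun i =>
    ∑ j : Fin n, t (.inr (i, j)) • (of fun a b => t (.inl (a, b))) ^ (j : ℕ)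

theorem polyTuple_zero {R : Type*} [CommRing R] (t : (Fin n × Fin n) ⊕ (Fin s × Fin n) → R) :
    polyTuple t 0 = of fun a b => t (.inl (a, b)) := rfl

theorem polyTuple_succ {R : Type*} [CommRing R] (t : (Fin n × Fin n) ⊕ (Fin s × Fin n) → R)
    (i : Fin s) : polyTuple t i.succ = ∑ j : Fin n, t (.inr (i, j)) • polyTuple t 0 ^ (j : ℕ) := rfl

theorem map_polyTuple {R S : Type*} [CommRing R] [CommRing S] (f : R →+* S)
    (t : (Fin n × Fin n) ⊕ (Fin s × Fin n) → R) (i : Fin (s + 1)) :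
    (polyTuple t i).map f = polyTuple (f ∘ t) i := by
  have h0 : (polyTuple t 0).map f = polyTuple (f ∘ t) 0 := rfl
  cases i using Fin.cases with
  | zero => exact h0
  | succ i =>
    rw [polyTuple_succ, polyTuple_succ, ← h0, ← RingHom.mapMatrix_apply, map_sum]
    refine Finset.sum_congr rfl fun j _ => ?_
    rw [← RingHom.mapMatrix_apply, ← map_pow]
    ext a b
    simp

theorem polyTuple_mem_commTuples {k : Type*} [Field k]
    (t : (Fin n × Fin n) ⊕ (Fin s × Fin n) → k) : polyTuple t ∈ commTuples k n (s + 1) := by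
  have h0 : ∀ i, Commute (polyTuple t i) (polyTuple t 0) := by
    intro i
    cases i using Fin.cases with
    | zero => exact Commute.refl _
    | succ i =>
      rw [polyTuple_succ]
      exact Commute.sum_left _ _ _ fun j _ => ((Commute.refl _).pow_left _).smul_left _
  intro i j
  cases i using Fin.cases with
  | zero => exact (h0 j).symm
  | succ i =>
    rw [polyTuple_succ]
    exact Commute.sum_left _ _ _ fun l _ => ((h0 j).symm.pow_left _).smul_left _

theorem exists_polyTuple_eq {k : Type*} [Field k] [Infinite k]
    {x : Fin (s + 1) → Matrix (Fin n) (Fin n) k} (hx : x ∈ commTuples k n (s + 1))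
    (h0 : (minpoly k (x 0)).natDegree = n) : ∃ t, polyTuple t = x := by
  obtain ⟨v, hv⟩ := (natDegree_minpoly_eq_iff_exists_krylov _).1 h0
  choose c hc using fun i : Fin s => eq_sum_smul_pow_of_commute hv (hx i.succ 0)
  refine ⟨Sum.elim (fun q => x 0 q.1 q.2) fun q => c q.1 q.2, funext fun i => ?_⟩
  cases i using Fin.cases with
  | zero => rfl
  | succ i => exact (hc i).symm

/-- The comorphism of `polyTuple`. -/
noncomputable def polyTupleComorphism (k : Type*) [Field k] (n s : ℕ) :
    MvPolynomial (Fin (s + 1) × Fin n × Fin n) k →ₐ[k]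
      MvPolynomial ((Fin n × Fin n) ⊕ (Fin s × Fin n)) k :=
  aeval (entries (polyTuple X))

variable {k : Type*} [Field k]

theorem eval_polyTupleComorphism (t : (Fin n × Fin n) ⊕ (Fin s × Fin n) → k)
    (p : MvPolynomial (Fin (s + 1) × Fin n × Fin n) k) :
    eval t (polyTupleComorphism k n s p) = eval (entries (polyTuple t)) p := by
  have hX : eval t ∘ X = t := funext fun q => eval_X q
  suffices h : (aeval t).comp (polyTupleComorphism k n s) = aeval (entries (polyTuple t)) by
    simpa [coe_aeval_eq_eval] using DFunLike.congr_fun h p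
  refine algHom_ext fun q => ?_
  have := congrFun₂ (map_polyTuple (eval t) X q.1) q.2.1 q.2.2
  rw [hX] at this
  simpa [polyTupleComorphism, coe_aeval_eq_eval, entries] using this

theorem map_polyTupleComorphism_genericTuple (i : Fin (s + 1)) :
    (genericTuple k n (s + 1) i).map (polyTupleComorphism k n s) = polyTuple X i :=
  map_genericTuple (polyTupleComorphism k n s).toRingHom (fun q => aeval_X _ q) i

theorem det_krylov_polyTuple_X_ne_zero [Infinite k] :
    (krylov (polyTuple (X : _ → MvPolynomial ((Fin n × Fin n) ⊕ (Fin s × Fin n)) k) 0) 1).det ≠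
      0 := by
  intro h
  let a : Fin n → k := fun i => Infinite.natEmbedding k i
  have ha : Function.Injective a := (Infinite.natEmbedding k).injective.comp Fin.val_injective
  let t : (Fin n × Fin n) ⊕ (Fin s × Fin n) → k := Sum.elim (fun q => diagonal a q.1 q.2) 0
  have hX : eval t ∘ X = t := funext fun q => eval_X q
  have ht : polyTuple t 0 = diagonal a := rfl
  have h1 : eval t ∘ (1 : Fin n → MvPolynomial ((Fin n × Fin n) ⊕ (Fin s × Fin n)) k) = 1 :=
    funext fun _ => map_one _
  have := congrArg (eval t) h
  rw [RingHom.map_det, RingHom.mapMatrix_apply, map_krylov, map_polyTuple, hX, h1, ht,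
    krylov_diagonal_one, map_zero] at this
  exact det_vandermonde_ne_zero_iff.2 ha this

theorem map_det_krylov_of_map_eq_polyTuple {R S : Type*} [CommRing R] [CommRing S] (f : R →+* S)
    {x : Fin (s + 1) → Matrix (Fin n) (Fin n) R} {t : (Fin n × Fin n) ⊕ (Fin s × Fin n) → S}
    (hx : ∀ i, (x i).map f = polyTuple t i) :
    f (krylov (x 0) 1).det = (krylov (polyTuple t 0) 1).det := by
  have h1 : f ∘ (1 : Fin n → R) = 1 := funext fun _ => map_one f
  rw [RingHom.map_det, RingHom.mapMatrix_apply, map_krylov, h1, hx]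

/-- Cramer's rule recovers the coefficients of the polynomials in `polyTuple t`. -/
theorem map_adjugate_krylov_of_map_eq_polyTuple {R S : Type*} [CommRing R] [CommRing S]
    (f : R →+* S) {x : Fin (s + 1) → Matrix (Fin n) (Fin n) R}
    {t : (Fin n × Fin n) ⊕ (Fin s × Fin n) → S} (hx : ∀ i, (x i).map f = polyTuple t i)
    (i : Fin s) (j : Fin n) :
    f (((krylov (x 0) 1).adjugate *ᵥ (x i.succ *ᵥ 1)) j) =
      (krylov (polyTuple t 0) 1).det * t (.inr (i, j)) := by
  have h1 : f ∘ (1 : Fin n → R) = 1 := funext fun _ => map_one f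
  have hadj : (krylov (x 0) 1).adjugate.map f = (krylov (polyTuple t 0) 1).adjugate := by
    rw [← RingHom.mapMatrix_apply, RingHom.map_adjugate, RingHom.mapMatrix_apply, map_krylov, h1,
      hx]
  have hmul : f ∘ (x i.succ *ᵥ 1) = polyTuple t i.succ *ᵥ 1 := by
    rw [← hx, ← h1]
    exact funext fun l => RingHom.map_mulVec f _ _ l
  rw [RingHom.map_mulVec, hadj, hmul, polyTuple_succ,
    ← krylov_mulVec (polyTuple t 0) 1 fun j => t (.inr (i, j)),
    mulVec_mulVec, adjugate_mul, smul_mulVec, one_mulVec, Pi.smul_apply, smul_eq_mul]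

theorem exists_map_mul_eq_map_of_map_eq_polyTuple {R S : Type*} [CommRing R] [CommRing S]
    [Nontrivial S] (f : R →+* S) {x : Fin (s + 1) → Matrix (Fin n) (Fin n) R}
    {t : (Fin n × Fin n) ⊕ (Fin s × Fin n) → S} (hx : ∀ i, (x i).map f = polyTuple t i)
    (ht : (krylov (polyTuple t 0) 1).det ≠ 0) (q : (Fin n × Fin n) ⊕ (Fin s × Fin n)) :
    ∃ d a, f d ≠ 0 ∧ f d * t q = f a := by
  obtain ⟨a, b⟩ | ⟨i, j⟩ := q
  · refine ⟨1, x 0 a b, by simp, ?_⟩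
    rw [map_one, one_mul]
    exact (congrFun₂ (hx 0) a b).symm
  · have hd := map_det_krylov_of_map_eq_polyTuple f hx
    exact ⟨_, _, hd.trans_ne ht, (congrArg (· * t (.inr (i, j))) hd).trans
      (map_adjugate_krylov_of_map_eq_polyTuple f hx i j).symm⟩

theorem ringKrullDim_quotient_ker_polyTupleComorphism [Infinite k] :
    ringKrullDim (MvPolynomial (Fin (s + 1) × Fin n × Fin n) k ⧸
      RingHom.ker (polyTupleComorphism k n s)) = (n ^ 2 + s * n : ℕ) := by
  have h := ringKrullDim_quotient_ker_eq_card (polyTupleComorphism k n s)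
    (exists_map_mul_eq_map_of_map_eq_polyTuple (polyTupleComorphism k n s).toRingHom
      map_polyTupleComorphism_genericTuple det_krylov_polyTuple_X_ne_zero)
  rw [h]
  simp [sq]

theorem Gnr_eq_preimage_zeroLocus [Infinite k] :
    Gnr k n (s + 1) = toSpec ⁻¹'
      PrimeSpectrum.zeroLocus (RingHom.ker (polyTupleComorphism k n s) : Set _) := by
  let := matTupleZariski k n (s + 1)
  refine (closure_minimal ?_ ?_).antisymm ?_
  · rintro x ⟨hx, h0⟩ p hp
    obtain ⟨t, rfl⟩ := exists_polyTuple_eq hx (h0 0 rfl)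
    rw [SetLike.mem_coe, mem_toSpec_asIdeal, ← eval_polyTupleComorphism, RingHom.mem_ker.1 hp,
      map_zero]
  · exact (PrimeSpectrum.isClosed_zeroLocus _).preimage isInducing_toSpec.continuous
  · intro x hx
    obtain ⟨C, hC, hCG⟩ := isInducing_toSpec.isClosed_iff.1
      (isClosed_closure : IsClosed (Gnr k n (s + 1)))
    obtain ⟨I, rfl⟩ := (PrimeSpectrum.isClosed_iff_zeroLocus _).1 hC
    rw [← hCG]
    refine fun p hp => hx (RingHom.mem_ker.2 ?_)
    refine (mul_eq_zero.1 (?_ : (krylov (polyTuple X 0) 1).det * _ = 0)).resolve_left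
      det_krylov_polyTuple_X_ne_zero
    refine MvPolynomial.funext fun t => ?_
    rw [map_mul, map_zero, eval_polyTupleComorphism]
    by_cases ht : (krylov (polyTuple t 0) 1).det = 0
    · have hX : eval t ∘ X = t := funext fun q => eval_X q
      have h1 : eval t ∘ (1 : Fin n → MvPolynomial ((Fin n × Fin n) ⊕ (Fin s × Fin n)) k) = 1 :=
        funext fun _ => map_one _
      rw [RingHom.map_det, RingHom.mapMatrix_apply, map_krylov, map_polyTuple, hX, h1, ht, zero_mul]
    · have hmem : polyTuple t ∈ Gnr k n (s + 1) := by
        refine subset_closure ⟨polyTuple_mem_commTuples t, fun i hi => ?_⟩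
        obtain rfl : i = 0 := Fin.ext hi
        exact (natDegree_minpoly_eq_iff_exists_krylov _).2 ⟨1, ht⟩
      change _ ∈ closure _ at hmem
      rw [← hCG] at hmem
      rw [mem_toSpec_asIdeal.1 (hmem hp), mul_zero]

end Parametrization

/-- For all integers `n, r ≥ 2`, `C_r(Mat_n(k))` is irreducible iff it equals `G_n^r`;
moreover `G_n^r` has dimension `n² + (r-1)n`, so if `C_r(Mat_n(k))` is irreducible then
its dimension is `n² + (r-1)n`. -/
theorem commTuples_irreducible_iff (k : Type*) [Field k] [IsAlgClosed k]
    (n r : ℕ) (hn : 2 ≤ n) (hr : 2 ≤ r) :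
    letI := matTupleZariski k n r
    (IsIrreducible (commTuples k n r) ↔ commTuples k n r = Gnr k n r) ∧
      topologicalKrullDim (Gnr k n r) = (n ^ 2 + (r - 1) * n : ℕ) ∧
      (IsIrreducible (commTuples k n r) →
        topologicalKrullDim (commTuples k n r) = (n ^ 2 + (r - 1) * n : ℕ)) := by
  obtain ⟨s, rfl⟩ : ∃ s, r = s + 1 := ⟨r - 1, by omega⟩
  let := matTupleZariski k n (s + 1)
  have hinf : Infinite k := IsAlgClosed.instInfinite
  have hG := Gnr_eq_preimage_zeroLocus (k := k) (n := n) (s := s)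
  have hprime : (RingHom.ker (polyTupleComorphism k n s)).IsPrime := RingHom.ker_isPrime _
  have hZ := PrimeSpectrum.isClosed_zeroLocus
    (RingHom.ker (polyTupleComorphism k n s) : Set (MvPolynomial (Fin (s + 1) × Fin n × Fin n) k))
  have hirr : IsIrreducible (Gnr k n (s + 1)) := by
    rw [hG]
    exact isInducing_toSpec.isIrreducible_preimage closure_inter_range_toSpec hZ
      ((PrimeSpectrum.isIrreducible_zeroLocus_iff_of_radical _ hprime.isRadical).2 hprime)
  have hiff : IsIrreducible (commTuples k n (s + 1)) ↔
      commTuples k n (s + 1) = Gnr k n (s + 1) := by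
    refine ⟨fun h => ?_, fun h => h ▸ hirr⟩
    refine Set.Subset.antisymm ?_ (closure_minimal (fun x hx => hx.1) isClosed_commTuples)
    obtain ⟨x, hx, h0⟩ := closure_nonempty_iff.1 hirr.1
    refine (subset_closure_inter_of_isPreirreducible_of_isOpen h.2
      (isOpen_setOf_nonderogatory 0) ⟨x, hx, h0 0 rfl⟩).trans (closure_mono ?_)
    rintro y ⟨hy, hy0⟩
    refine ⟨hy, fun i hi => ?_⟩
    obtain rfl : i = 0 := Fin.ext hi
    exact hy0
  have hdim : topologicalKrullDim (Gnr k n (s + 1)) = (n ^ 2 + (s + 1 - 1) * n : ℕ) := by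
    rw [hG, isInducing_toSpec.topologicalKrullDim_preimage_eq closure_inter_range_toSpec hZ,
      PrimeSpectrum.topologicalKrullDim_zeroLocus,
      ringKrullDim_quotient_ker_polyTupleComorphism, Nat.add_sub_cancel]
  exact ⟨hiff, hdim, fun h => hiff.1 h ▸ hdim⟩
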